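/- Let L be a lattice with a least element. The following are equivalent: (i) the tensor product M₃ ⊗ L is a lattice; (ii) for every (x, y, z) ∈ L³ there exists n > 0 with (x, y, z)^{(n)} = (x, y, z)^{(n+1)}. Moreover, if (i) holds, then M₃ ⊗ L is isomorphic to the lattice M₃[L] of balanced triples. In particular, if L is n-modular for some n > 0, then M₃ ⊗ L is a lattice isomorphic to M₃[L]. -/

import Mathlib

section TensorDefs

variable {α β : Type*} [Lattice α] [OrderBot α] [Lattice β] [OrderBot β]

/-- `∇ = (A × {0}) ∪ ({0} × B)`. -/
def nablaSet (α β : Type*) [Lattice α] [OrderBot α] [Lattice β] [OrderBot β] :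
    Set (α × β) :=
  {p | p.1 = ⊥ ∨ p.2 = ⊥}

/-- A *bi-ideal* of `A × B`: a down-set containing `∇` and closed under joins in each
coordinate separately. -/
def IsBiIdeal (I : Set (α × β)) : Prop :=
  IsLowerSet I ∧ nablaSet α β ⊆ I ∧
  (∀ a₀ a₁ b, (a₀, b) ∈ I → (a₁, b) ∈ I → (a₀ ⊔ a₁, b) ∈ I) ∧
  (∀ a b₀ b₁, (a, b₀) ∈ I → (a, b₁) ∈ I → (a, b₀ ⊔ b₁) ∈ I)

/-- Membership in the tensor product `A ⊗ B`: the bi-ideals that are finite joins of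
pure tensors `a ⊗ b`, i.e. the smallest bi-ideal containing some finite subset of `A × B`. -/
def InTensor (I : Set (α × β)) : Prop :=
  ∃ s : Finset (α × β), I = ⋂₀ {J : Set (α × β) | IsBiIdeal J ∧ ↑s ⊆ J}

end TensorDefs

/-- The tensor product `A ⊗ B`, as a partially ordered set (ordered by inclusion). -/
abbrev TensorProd (α β : Type*) [Lattice α] [OrderBot α] [Lattice β] [OrderBot β] :=
  {I : Set (α × β) // InTensor I}

/-- `M` is the lattice `M₃`: it consists of the five distinct elements `⊥, a, b, c, ⊤`,
where `a`, `b`, `c` are three atoms with pairwise meets `⊥` and pairwise joins `⊤`. -/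
def IsM3 (M : Type*) [Lattice M] [BoundedOrder M] (a b c : M) : Prop :=
  (∀ x : M, x = ⊥ ∨ x = a ∨ x = b ∨ x = c ∨ x = ⊤) ∧
  a ≠ b ∧ a ≠ c ∧ b ≠ c ∧ a ≠ ⊥ ∧ b ≠ ⊥ ∧ c ≠ ⊥ ∧ a ≠ ⊤ ∧ b ≠ ⊤ ∧ c ≠ ⊤ ∧
  (⊥ : M) ≠ ⊤ ∧
  a ⊓ b = ⊥ ∧ a ⊓ c = ⊥ ∧ b ⊓ c = ⊥ ∧ a ⊔ b = ⊤ ∧ a ⊔ c = ⊤ ∧ b ⊔ c = ⊤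

/-- A triple `(x, y, z)` in a lattice is *balanced* if `x ⊓ y = x ⊓ z = y ⊓ z`. -/
def IsBalanced {α : Type*} [Lattice α] (t : α × α × α) : Prop :=
  t.1 ⊓ t.2.1 = t.1 ⊓ t.2.2 ∧ t.1 ⊓ t.2.2 = t.2.1 ⊓ t.2.2

/-- One step of the balancing sequence; `adjT^[n] (x,y,z) = (x,y,z)⁽ⁿ⁾`. -/
def adjT {α : Type*} [Lattice α] (t : α × α × α) : α × α × α :=
  (t.1 ⊔ t.2.1 ⊓ t.2.2, t.2.1 ⊔ t.1 ⊓ t.2.2, t.2.2 ⊔ t.1 ⊓ t.2.1)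

/-- A lattice is `n`-modular (satisfies the identity `γₙ : pₙ = pₙ₊₁`). -/
def NModular (α : Type*) [Lattice α] (n : ℕ) : Prop :=
  ∀ t : α × α × α, (adjT^[n] t).1 = (adjT^[n + 1] t).1

section BiIdeal

variable {α β : Type*} [Lattice α] [OrderBot α] [Lattice β] [OrderBot β]

theorem IsBiIdeal.sInter {S : Set (Set (α × β))} (hS : ∀ I ∈ S, IsBiIdeal I) :
    IsBiIdeal (⋂₀ S) := by
  refine ⟨fun x y hyx hx I hI => (hS I hI).1 hyx (hx I hI),
    fun x hx I hI => (hS I hI).2.1 hx, fun a₀ a₁ b h₀ h₁ I hI => ?_,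
    fun a b₀ b₁ h₀ h₁ I hI => ?_⟩
  · exact (hS I hI).2.2.1 _ _ _ (h₀ I hI) (h₁ I hI)
  · exact (hS I hI).2.2.2 _ _ _ (h₀ I hI) (h₁ I hI)

/-- The bi-ideal generated by a set. -/
def biIdealClosure (s : Set (α × β)) : Set (α × β) :=
  ⋂₀ {J : Set (α × β) | IsBiIdeal J ∧ s ⊆ J}

theorem isBiIdeal_biIdealClosure (s : Set (α × β)) : IsBiIdeal (biIdealClosure s) :=
  IsBiIdeal.sInter fun _ hI => hI.1

theorem subset_biIdealClosure (s : Set (α × β)) : s ⊆ biIdealClosure s :=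
  fun _ hx _ hI => hI.2 hx

theorem biIdealClosure_subset_iff {s I : Set (α × β)} (hI : IsBiIdeal I) :
    biIdealClosure s ⊆ I ↔ s ⊆ I :=
  ⟨fun h => (subset_biIdealClosure s).trans h, fun h _ hx => hx I ⟨hI, h⟩⟩

theorem InTensor.isBiIdeal {I : Set (α × β)} (hI : InTensor I) : IsBiIdeal I := by
  obtain ⟨s, rfl⟩ := hI
  exact isBiIdeal_biIdealClosure _

theorem inTensor_of_forall_subset_iff {I : Set (α × β)} (hI : IsBiIdeal I)
    (s : Finset (α × β)) (h : ∀ J, IsBiIdeal J → (I ⊆ J ↔ ↑s ⊆ J)) : InTensor I :=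
  ⟨s, Set.Subset.antisymm (Set.subset_sInter fun J hJ => (h J hJ.1).2 hJ.2)
    (Set.sInter_subset_of_mem ⟨hI, (h I hI).1 subset_rfl⟩)⟩

/-- Finite joins always exist in the tensor product. -/
theorem TensorProd.exists_isLUB (I J : TensorProd α β) : ∃ K, IsLUB {I, J} K := by
  classical
  obtain ⟨I, s, rfl⟩ := I
  obtain ⟨J, t, rfl⟩ := J
  refine ⟨⟨biIdealClosure ↑(s ∪ t), s ∪ t, rfl⟩, ?_, fun K hK => ?_⟩
  · have h : ∀ r : Finset (α × β), r ⊆ s ∪ t →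
        biIdealClosure (r : Set (α × β)) ⊆ biIdealClosure ↑(s ∪ t) := fun r hr =>
      (biIdealClosure_subset_iff (isBiIdeal_biIdealClosure _)).2
        ((Finset.coe_subset.2 hr).trans (subset_biIdealClosure _))
    rintro K (rfl | rfl)
    · exact h s Finset.subset_union_left
    · exact h t Finset.subset_union_right
  · have hs : biIdealClosure (s : Set (α × β)) ⊆ K.1 := hK (Or.inl rfl)
    have ht : biIdealClosure (t : Set (α × β)) ⊆ K.1 := hK (Or.inr rfl)
    rw [biIdealClosure_subset_iff K.2.isBiIdeal] at hs ht
    refine (biIdealClosure_subset_iff K.2.isBiIdeal).2 ?_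
    rw [Finset.coe_union]
    exact Set.union_subset hs ht

/-- The bi-ideal `e ⊗ w`. -/
def pureBiIdeal (e : α) (w : β) : Set (α × β) :=
  {p | p.1 = ⊥ ∨ p.2 = ⊥ ∨ (p.1 ≤ e ∧ p.2 ≤ w)}

theorem isBiIdeal_pureBiIdeal (e : α) (w : β) : IsBiIdeal (pureBiIdeal e w) := by
  refine ⟨?_, ?_, ?_, ?_⟩
  · rintro ⟨x₁, x₂⟩ ⟨y₁, y₂⟩ ⟨h₁, h₂⟩ (h | h | ⟨h, h'⟩)
    · exact Or.inl (le_bot_iff.1 (h₁.trans_eq h))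
    · exact Or.inr (Or.inl (le_bot_iff.1 (h₂.trans_eq h)))
    · exact Or.inr (Or.inr ⟨h₁.trans h, h₂.trans h'⟩)
  · rintro p (h | h)
    · exact Or.inl h
    · exact Or.inr (Or.inl h)
  · rintro a₀ a₁ u (h | h | ⟨h, h'⟩) (k | k | ⟨k, k'⟩) <;>
      simp_all [pureBiIdeal]
  · rintro u b₀ b₁ (h | h | ⟨h, h'⟩) (k | k | ⟨k, k'⟩) <;>
      simp_all [pureBiIdeal]

theorem pureBiIdeal_subset_iff {e : α} {w : β} {J : Set (α × β)} (hJ : IsBiIdeal J) :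
    pureBiIdeal e w ⊆ J ↔ (e, w) ∈ J := by
  refine ⟨fun h => h (Or.inr (Or.inr ⟨le_rfl, le_rfl⟩)), fun h p hp => ?_⟩
  rcases hp with hp | hp | hp
  · exact hJ.2.1 (Or.inl hp)
  · exact hJ.2.1 (Or.inr hp)
  · exact hJ.1 (Prod.mk_le_mk.2 hp) h

theorem inTensor_pureBiIdeal (e : α) (w : β) : InTensor (pureBiIdeal e w) :=
  inTensor_of_forall_subset_iff (isBiIdeal_pureBiIdeal e w) {(e, w)} fun J hJ => by
    rw [pureBiIdeal_subset_iff hJ, Finset.coe_singleton, Set.singleton_subset_iff]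

theorem exists_subset_pureBiIdeal {e : α} (he : IsAtom e) {w : β} {J : Set (α × β)}
    (hJ : IsBiIdeal J) (s : Finset (α × β)) (hsJ : ↑s ⊆ J) (hsw : ↑s ⊆ pureBiIdeal e w) :
    ∃ p, (e, p) ∈ J ∧ ↑s ⊆ pureBiIdeal e p := by
  classical
  induction s using Finset.induction_on with
  | empty => exact ⟨⊥, hJ.2.1 (Or.inr rfl), by simp⟩
  | insert q s _ ih =>
    rw [Finset.coe_insert, Set.insert_subset_iff] at hsJ hsw
    obtain ⟨p, hp, hs⟩ := ih hsJ.2 hsw.2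
    by_cases hq : q.1 = ⊥ ∨ q.2 = ⊥
    · refine ⟨p, hp, ?_⟩
      rw [Finset.coe_insert, Set.insert_subset_iff]
      exact ⟨(isBiIdeal_pureBiIdeal e p).2.1 hq, hs⟩
    · have hqe : q.1 = e := by
        rcases hsw.1 with h | h | ⟨h, -⟩
        · exact absurd (Or.inl h) hq
        · exact absurd (Or.inr h) hq
        · exact (he.le_iff.1 h).resolve_left fun h => hq (Or.inl h)
      have hqJ : (e, q.2) ∈ J := hqe ▸ hsJ.1
      refine ⟨p ⊔ q.2, hJ.2.2.2 _ _ _ hp hqJ, ?_⟩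
      rw [Finset.coe_insert, Set.insert_subset_iff]
      refine ⟨Or.inr (Or.inr ⟨hqe.le, le_sup_right⟩), hs.trans ?_⟩
      rw [pureBiIdeal_subset_iff (isBiIdeal_pureBiIdeal _ _)]
      exact Or.inr (Or.inr ⟨le_rfl, le_sup_left⟩)

/-- If binary meets exist in the tensor product, then a bounded section of one of its members
over an atom is a principal ideal. -/
theorem TensorProd.exists_isGreatest_section
    (hglb : ∀ I J : TensorProd α β, ∃ K, IsGLB {I, J} K) {e : α} (he : IsAtom e)
    (I : TensorProd α β) (hI : BddAbove {u | (e, u) ∈ I.1}) :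
    ∃ p, IsGreatest {u | (e, u) ∈ I.1} p := by
  obtain ⟨w, hw⟩ := hI
  obtain ⟨⟨K, s, rfl⟩, hK⟩ := hglb I ⟨_, inTensor_pureBiIdeal e w⟩
  have hKI : biIdealClosure (s : Set (α × β)) ⊆ I.1 := hK.1 (Or.inl rfl)
  have hKw : biIdealClosure (s : Set (α × β)) ⊆ pureBiIdeal e w := hK.1 (Or.inr rfl)
  obtain ⟨p, hp, hs⟩ := exists_subset_pureBiIdeal he (isBiIdeal_biIdealClosure ↑s) s
    (subset_biIdealClosure _) ((subset_biIdealClosure _).trans hKw)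
  refine ⟨p, hKI hp, fun u hu => ?_⟩
  have hle : (⟨_, inTensor_pureBiIdeal e u⟩ : TensorProd α β) ≤
      ⟨biIdealClosure (s : Set (α × β)), s, rfl⟩ := by
    refine hK.2 ?_
    rintro J (hJ | hJ)
    · subst hJ
      exact (pureBiIdeal_subset_iff J.2.isBiIdeal).2 hu
    · subst hJ
      exact (pureBiIdeal_subset_iff (isBiIdeal_pureBiIdeal e w)).2
        (Or.inr (Or.inr ⟨le_rfl, hw hu⟩))
  have hmem : (e, u) ∈ biIdealClosure (s : Set (α × β)) :=
    (pureBiIdeal_subset_iff (isBiIdeal_biIdealClosure _)).1 hle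
  rcases (biIdealClosure_subset_iff (isBiIdeal_pureBiIdeal e p)).2 hs hmem with h | h | h
  · exact absurd h he.1
  · exact (show u = ⊥ from h) ▸ bot_le
  · exact h.2

end BiIdeal

section Adjust

variable {α : Type*} [Lattice α]

theorem le_adjT (t : α × α × α) : t ≤ adjT t :=
  ⟨le_sup_left, le_sup_left, le_sup_left⟩

theorem monotone_iterate_adjT (t : α × α × α) : Monotone fun n => adjT^[n] t :=
  monotone_nat_of_le_succ fun n => by
    rw [Function.iterate_succ_apply']
    exact le_adjT _

theorem isBalanced_iff_adjT_eq {t : α × α × α} : IsBalanced t ↔ adjT t = t := by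
  obtain ⟨x, y, z⟩ := t
  simp only [IsBalanced, adjT, Prod.mk.injEq, sup_eq_left]
  constructor
  · rintro ⟨h₁, h₂⟩
    exact ⟨h₂ ▸ inf_le_left, (h₂ ▸ inf_le_left : x ⊓ z ≤ y), h₁ ▸ inf_le_right⟩
  · rintro ⟨h₁, h₂, h₃⟩
    exact ⟨le_antisymm (le_inf inf_le_left h₃) (le_inf inf_le_left h₂),
      le_antisymm (le_inf h₂ inf_le_right) (le_inf h₁ inf_le_right)⟩

theorem IsBalanced.inf {t t' : α × α × α} (h : IsBalanced t) (h' : IsBalanced t') :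
    IsBalanced (t ⊓ t') := by
  obtain ⟨x, y, z⟩ := t
  obtain ⟨x', y', z'⟩ := t'
  simp only [IsBalanced, Prod.mk_inf_mk] at *
  simp only [inf_inf_inf_comm _ _ _ _, h.1, h.2, h'.1, h'.2, and_self]

theorem NModular.iterate_adjT_eq {n : ℕ} (h : NModular α n) (t : α × α × α) :
    adjT^[n] t = adjT^[n + 1] t := by
  have h₂ : Function.Semiconj (fun t : α × α × α => (t.2.1, t.1, t.2.2)) adjT adjT :=
    fun t => by simp only [adjT, inf_comm]
  have h₃ : Function.Semiconj (fun t : α × α × α => (t.2.2, t.2.1, t.1)) adjT adjT :=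
    fun t => by simp only [adjT, inf_comm]
  refine Prod.ext (h t) (Prod.ext ?_ ?_)
  · have := h (t.2.1, t.1, t.2.2)
    rwa [← (h₂.iterate_right n) t, ← (h₂.iterate_right (n + 1)) t] at this
  · have := h (t.2.2, t.2.1, t.1)
    rwa [← (h₃.iterate_right n) t, ← (h₃.iterate_right (n + 1)) t] at this

end Adjust

section TripleSet

variable {M α : Type*} [Lattice M] [Lattice α] {a b c : M}

/-- The subset of `M₃ × L` whose sections over the three atoms are the principal ideals
generated by the components of `t`. -/
def tripleSet (a b c : M) (t : α × α × α) : Set (M × α) :=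
  {p | (a ≤ p.1 → p.2 ≤ t.1) ∧ (b ≤ p.1 → p.2 ≤ t.2.1) ∧ (c ≤ p.1 → p.2 ≤ t.2.2)}

/-- The set `J` contains `(a, x)`, `(b, y)` and `(c, z)`, where `t = (x, y, z)`. -/
def ContainsTriple (a b c : M) (J : Set (M × α)) (t : α × α × α) : Prop :=
  (a, t.1) ∈ J ∧ (b, t.2.1) ∈ J ∧ (c, t.2.2) ∈ J

theorem tripleSet_mono {t t' : α × α × α} (h : t ≤ t') :
    tripleSet a b c t ⊆ tripleSet a b c t' := fun _ hp =>
  ⟨fun k => (hp.1 k).trans h.1, fun k => (hp.2.1 k).trans h.2.1,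
    fun k => (hp.2.2 k).trans h.2.2⟩

theorem isLowerSet_tripleSet (t : α × α × α) : IsLowerSet (tripleSet a b c t) :=
  fun _ _ hqp hp =>
    ⟨fun k => hqp.2.trans (hp.1 (k.trans hqp.1)), fun k => hqp.2.trans (hp.2.1 (k.trans hqp.1)),
      fun k => hqp.2.trans (hp.2.2 (k.trans hqp.1))⟩

theorem sup_mem_tripleSet {t : α × α × α} {m : M} {u v : α}
    (hu : (m, u) ∈ tripleSet a b c t) (hv : (m, v) ∈ tripleSet a b c t) :
    (m, u ⊔ v) ∈ tripleSet a b c t :=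
  ⟨fun k => sup_le (hu.1 k) (hv.1 k), fun k => sup_le (hu.2.1 k) (hv.2.1 k),
    fun k => sup_le (hu.2.2 k) (hv.2.2 k)⟩

theorem tripleSet_inf (t t' : α × α × α) :
    tripleSet a b c (t ⊓ t') = tripleSet a b c t ∩ tripleSet a b c t' := by
  ext p
  simp only [tripleSet, Set.mem_ofPred_eq, Set.mem_inter_iff, Prod.fst_inf, Prod.snd_inf,
    le_inf_iff]
  tauto

end TripleSet

section DiamondTensor

variable {M : Type*} [Lattice M] [BoundedOrder M] {a b c : M}

theorem IsM3.swap_left (hM : IsM3 M a b c) : IsM3 M b a c := by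
  unfold IsM3 at *
  rw [inf_comm b a, sup_comm b a]
  obtain ⟨hall, h⟩ := hM
  exact ⟨fun x => by have := hall x; tauto, by tauto⟩

theorem IsM3.swap_right (hM : IsM3 M a b c) : IsM3 M a c b := by
  unfold IsM3 at *
  rw [inf_comm c b, sup_comm c b]
  obtain ⟨hall, h⟩ := hM
  exact ⟨fun x => by have := hall x; tauto, by tauto⟩

theorem IsM3.isAtom (hM : IsM3 M a b c) : IsAtom a := by
  obtain ⟨hall, hab, hac, hbc, ha, hb, hc, ha', hb', hc', hbt, iab, iac, ibc, -⟩ := hM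
  refine ⟨ha, fun x hx => ?_⟩
  rcases hall x with rfl | rfl | rfl | rfl | rfl
  · rfl
  · exact absurd rfl hx.ne
  · rwa [inf_eq_right.2 hx.le] at iab
  · rwa [inf_eq_right.2 hx.le] at iac
  · exact absurd (top_le_iff.1 hx.le) ha'

theorem IsM3.not_le (hM : IsM3 M a b c) : ¬ a ≤ b := fun h => by
  obtain ⟨-, -, -, -, ha, -, -, -, -, -, -, iab, -⟩ := hM
  exact ha (by rwa [inf_eq_left.2 h] at iab)

theorem IsM3.le_sup_cases (hM : IsM3 M a b c) {m₀ m₁ : M} (h : a ≤ m₀ ⊔ m₁) :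
    a ≤ m₀ ∨ a ≤ m₁ ∨ (b ≤ m₀ ∧ c ≤ m₁) ∨ (c ≤ m₀ ∧ b ≤ m₁) := by
  have hab := hM.not_le
  have hac := hM.swap_right.not_le
  rcases hM.1 m₀ with rfl | rfl | rfl | rfl | rfl <;>
    rcases hM.1 m₁ with rfl | rfl | rfl | rfl | rfl <;> simp_all

variable {α : Type*} [Lattice α]

theorem IsM3.sup_mem_tripleSet_adjT (hM : IsM3 M a b c) {t : α × α × α} {m₀ m₁ : M} {u : α}
    (h₀ : (m₀, u) ∈ tripleSet a b c t) (h₁ : (m₁, u) ∈ tripleSet a b c t) :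
    (m₀ ⊔ m₁, u) ∈ tripleSet a b c (adjT t) := by
  obtain ⟨ha₀, hb₀, hc₀⟩ := h₀
  obtain ⟨ha₁, hb₁, hc₁⟩ := h₁
  refine ⟨fun k => ?_, fun k => ?_, fun k => ?_⟩
  · rcases hM.le_sup_cases k with k | k | ⟨k, k'⟩ | ⟨k, k'⟩
    · exact le_sup_of_le_left (ha₀ k)
    · exact le_sup_of_le_left (ha₁ k)
    · exact le_sup_of_le_right (le_inf (hb₀ k) (hc₁ k'))
    · exact le_sup_of_le_right (le_inf (hb₁ k') (hc₀ k))
  · rcases hM.swap_left.le_sup_cases k with k | k | ⟨k, k'⟩ | ⟨k, k'⟩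
    · exact le_sup_of_le_left (hb₀ k)
    · exact le_sup_of_le_left (hb₁ k)
    · exact le_sup_of_le_right (le_inf (ha₀ k) (hc₁ k'))
    · exact le_sup_of_le_right (le_inf (ha₁ k') (hc₀ k))
  · rcases hM.swap_right.swap_left.le_sup_cases k with k | k | ⟨k, k'⟩ | ⟨k, k'⟩
    · exact le_sup_of_le_left (hc₀ k)
    · exact le_sup_of_le_left (hc₁ k)
    · exact le_sup_of_le_right (le_inf (ha₀ k) (hb₁ k'))
    · exact le_sup_of_le_right (le_inf (ha₁ k') (hb₀ k))

theorem IsM3.containsTriple_tripleSet (hM : IsM3 M a b c) (t : α × α × α) :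
    ContainsTriple a b c (tripleSet a b c t) t := by
  have hab := hM.not_le
  have hba := hM.swap_left.not_le
  have hac := hM.swap_right.not_le
  have hca := hM.swap_right.swap_left.not_le
  have hbc := hM.swap_left.swap_right.not_le
  have hcb := hM.swap_left.swap_right.swap_left.not_le
  simp [ContainsTriple, tripleSet, hab, hba, hac, hca, hbc, hcb]

theorem IsM3.containsTriple_tripleSet_iff (hM : IsM3 M a b c) {t t' : α × α × α} :
    ContainsTriple a b c (tripleSet a b c t') t ↔ t ≤ t' := by
  refine ⟨fun h => ⟨h.1.1 le_rfl, h.2.1.2.1 le_rfl, h.2.2.2.2 le_rfl⟩, fun h => ?_⟩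
  have ht := hM.containsTriple_tripleSet t
  exact ⟨tripleSet_mono h ht.1, tripleSet_mono h ht.2.1, tripleSet_mono h ht.2.2⟩

variable [OrderBot α]

theorem IsM3.nablaSet_subset_tripleSet (hM : IsM3 M a b c) (t : α × α × α) :
    nablaSet M α ⊆ tripleSet a b c t := by
  obtain ⟨-, -, -, -, ha, hb, hc, -⟩ := hM
  rintro ⟨m, u⟩ (h | h) <;> simp_all [tripleSet]

theorem IsM3.isBiIdeal_iUnion_tripleSet (hM : IsM3 M a b c) (t : α × α × α) :
    IsBiIdeal (⋃ n : ℕ, tripleSet a b c (adjT^[n] t)) := by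
  have hmono : Monotone fun n : ℕ => tripleSet a b c (adjT^[n] t) :=
    fun i j hij => tripleSet_mono (monotone_iterate_adjT t hij)
  refine ⟨isLowerSet_iUnion fun n => isLowerSet_tripleSet _,
    (hM.nablaSet_subset_tripleSet t).trans
      (Set.subset_iUnion (fun n : ℕ => tripleSet a b c (adjT^[n] t)) 0), ?_, ?_⟩
  · intro m₀ m₁ u h₀ h₁
    obtain ⟨i, hi⟩ := Set.mem_iUnion.1 h₀
    obtain ⟨j, hj⟩ := Set.mem_iUnion.1 h₁
    refine Set.mem_iUnion.2 ⟨max i j + 1, ?_⟩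
    rw [Function.iterate_succ_apply']
    exact hM.sup_mem_tripleSet_adjT (hmono (le_max_left i j) hi) (hmono (le_max_right i j) hj)
  · intro m u v h₀ h₁
    obtain ⟨i, hi⟩ := Set.mem_iUnion.1 h₀
    obtain ⟨j, hj⟩ := Set.mem_iUnion.1 h₁
    exact Set.mem_iUnion.2 ⟨max i j,
      sup_mem_tripleSet (hmono (le_max_left i j) hi) (hmono (le_max_right i j) hj)⟩

theorem IsM3.isBiIdeal_tripleSet (hM : IsM3 M a b c) {t : α × α × α} (ht : IsBalanced t) :
    IsBiIdeal (tripleSet a b c t) := by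
  have h := hM.isBiIdeal_iUnion_tripleSet t
  simpa only [Function.iterate_fixed (isBalanced_iff_adjT_eq.1 ht), Set.iUnion_const] using h

theorem IsM3.tripleSet_subset_iff (hM : IsM3 M a b c) {J : Set (M × α)} (hJ : IsBiIdeal J)
    (t : α × α × α) : tripleSet a b c t ⊆ J ↔ ContainsTriple a b c J t := by
  constructor
  · intro h
    have ht := hM.containsTriple_tripleSet t
    exact ⟨h ht.1, h ht.2.1, h ht.2.2⟩
  · rintro ⟨hx, hy, hz⟩ ⟨m, u⟩ ⟨hu₁, hu₂, hu₃⟩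
    have hab : a ⊔ b = ⊤ := by
      obtain ⟨-, -, -, -, -, -, -, -, -, -, -, -, -, -, h, -⟩ := hM
      exact h
    rcases hM.1 m with rfl | rfl | rfl | rfl | rfl
    · exact hJ.2.1 (Or.inl rfl)
    · exact hJ.1 (Prod.mk_le_mk.2 ⟨le_rfl, hu₁ le_rfl⟩) hx
    · exact hJ.1 (Prod.mk_le_mk.2 ⟨le_rfl, hu₂ le_rfl⟩) hy
    · exact hJ.1 (Prod.mk_le_mk.2 ⟨le_rfl, hu₃ le_rfl⟩) hz
    · rw [← hab]
      exact hJ.2.2.1 _ _ _ (hJ.1 (Prod.mk_le_mk.2 ⟨le_rfl, hu₁ le_top⟩) hx)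
        (hJ.1 (Prod.mk_le_mk.2 ⟨le_rfl, hu₂ le_top⟩) hy)

theorem IsM3.inTensor_tripleSet (hM : IsM3 M a b c) {t : α × α × α} (ht : IsBalanced t) :
    InTensor (tripleSet a b c t) := by
  classical
  refine inTensor_of_forall_subset_iff (hM.isBiIdeal_tripleSet ht)
    {(a, t.1), (b, t.2.1), (c, t.2.2)} fun J hJ => ?_
  rw [hM.tripleSet_subset_iff hJ]
  simp [ContainsTriple, Set.insert_subset_iff]

theorem IsBiIdeal.mk_sup_mem_iff {J : Set (M × α)} (hJ : IsBiIdeal J) {m : M} {u v : α} :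
    (m, u ⊔ v) ∈ J ↔ (m, u) ∈ J ∧ (m, v) ∈ J :=
  ⟨fun h => ⟨hJ.1 (Prod.mk_le_mk.2 ⟨le_rfl, le_sup_left⟩) h,
    hJ.1 (Prod.mk_le_mk.2 ⟨le_rfl, le_sup_right⟩) h⟩, fun h => hJ.2.2.2 _ _ _ h.1 h.2⟩

theorem IsM3.mk_inf_mem (hM : IsM3 M a b c) {J : Set (M × α)} (hJ : IsBiIdeal J) {u v : α}
    (hu : (b, u) ∈ J) (hv : (c, v) ∈ J) : (a, u ⊓ v) ∈ J := by
  have hbc : b ⊔ c = ⊤ := by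
    obtain ⟨-, -, -, -, -, -, -, -, -, -, -, -, -, -, -, -, h⟩ := hM
    exact h
  refine hJ.1 (Prod.mk_le_mk.2 ⟨le_top, le_rfl⟩) (hbc ▸ hJ.2.2.1 b c (u ⊓ v) ?_ ?_)
  · exact hJ.1 (Prod.mk_le_mk.2 ⟨le_rfl, inf_le_left⟩) hu
  · exact hJ.1 (Prod.mk_le_mk.2 ⟨le_rfl, inf_le_right⟩) hv

theorem IsM3.containsTriple_adjT_iff (hM : IsM3 M a b c) {J : Set (M × α)} (hJ : IsBiIdeal J)
    (t : α × α × α) : ContainsTriple a b c J (adjT t) ↔ ContainsTriple a b c J t := by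
  simp only [ContainsTriple, adjT, hJ.mk_sup_mem_iff]
  refine ⟨fun h => ⟨h.1.1, h.2.1.1, h.2.2.1⟩, fun ⟨hx, hy, hz⟩ => ?_⟩
  exact ⟨⟨hx, hM.mk_inf_mem hJ hy hz⟩, ⟨hy, hM.swap_left.mk_inf_mem hJ hx hz⟩,
    ⟨hz, hM.swap_right.swap_left.mk_inf_mem hJ hx hy⟩⟩

theorem IsM3.containsTriple_iterate_adjT_iff (hM : IsM3 M a b c) {J : Set (M × α)}
    (hJ : IsBiIdeal J) (t : α × α × α) (n : ℕ) :
    ContainsTriple a b c J (adjT^[n] t) ↔ ContainsTriple a b c J t := by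
  induction n with
  | zero => rfl
  | succ n ih => rw [Function.iterate_succ_apply', hM.containsTriple_adjT_iff hJ, ih]

theorem IsM3.exists_containsTriple_iff_subset (hM : IsM3 M a b c) (s : Finset (M × α)) :
    ∃ t : α × α × α, ∀ J, IsBiIdeal J → (ContainsTriple a b c J t ↔ ↑s ⊆ J) := by
  classical
  induction s using Finset.induction_on with
  | empty =>
    refine ⟨⊥, fun J hJ => ?_⟩
    simpa using show ContainsTriple a b c J ⊥ from
      ⟨hJ.2.1 (Or.inr rfl), hJ.2.1 (Or.inr rfl), hJ.2.1 (Or.inr rfl)⟩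
  | insert q s _ ih =>
    obtain ⟨⟨x, y, z⟩, ht⟩ := ih
    obtain ⟨m, u⟩ := q
    simp only [Finset.coe_insert, Set.insert_subset_iff]
    have hab : a ⊔ b = ⊤ := by
      obtain ⟨-, -, -, -, -, -, -, -, -, -, -, -, -, -, h, -⟩ := hM
      exact h
    rcases hM.1 m with rfl | rfl | rfl | rfl | rfl
    · refine ⟨(x, y, z), fun J hJ => ?_⟩
      rw [ht J hJ, and_iff_right (hJ.2.1 (Or.inl rfl))]
    · refine ⟨(x ⊔ u, y, z), fun J hJ => ?_⟩
      rw [← ht J hJ]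
      simp only [ContainsTriple, hJ.mk_sup_mem_iff]
      tauto
    · refine ⟨(x, y ⊔ u, z), fun J hJ => ?_⟩
      rw [← ht J hJ]
      simp only [ContainsTriple, hJ.mk_sup_mem_iff]
      tauto
    · refine ⟨(x, y, z ⊔ u), fun J hJ => ?_⟩
      rw [← ht J hJ]
      simp only [ContainsTriple, hJ.mk_sup_mem_iff]
      tauto
    · refine ⟨(x ⊔ u, y ⊔ u, z ⊔ u), fun J hJ => ?_⟩
      rw [← ht J hJ]
      have htop : (⊤, u) ∈ J ↔ (a, u) ∈ J ∧ (b, u) ∈ J ∧ (c, u) ∈ J :=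
        ⟨fun h => ⟨hJ.1 (Prod.mk_le_mk.2 ⟨le_top, le_rfl⟩) h,
          hJ.1 (Prod.mk_le_mk.2 ⟨le_top, le_rfl⟩) h, hJ.1 (Prod.mk_le_mk.2 ⟨le_top, le_rfl⟩) h⟩,
          fun h => hab ▸ hJ.2.2.1 _ _ _ h.1 h.2.1⟩
      simp only [ContainsTriple, hJ.mk_sup_mem_iff, htop]
      tauto

theorem IsM3.exists_eq_tripleSet (hM : IsM3 M a b c)
    (hstab : ∀ t : α × α × α, ∃ n : ℕ, 0 < n ∧ adjT^[n] t = adjT^[n + 1] t)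
    {I : Set (M × α)} (hI : InTensor I) : ∃ t, IsBalanced t ∧ I = tripleSet a b c t := by
  obtain ⟨s, rfl⟩ := hI
  obtain ⟨t, ht⟩ := hM.exists_containsTriple_iff_subset s
  obtain ⟨n, -, hn⟩ := hstab t
  rw [Function.iterate_succ_apply'] at hn
  have hbal : IsBalanced (adjT^[n] t) := isBalanced_iff_adjT_eq.2 hn.symm
  have key : ∀ J, IsBiIdeal J → (tripleSet a b c (adjT^[n] t) ⊆ J ↔ ↑s ⊆ J) := fun J hJ => by
    rw [hM.tripleSet_subset_iff hJ, hM.containsTriple_iterate_adjT_iff hJ, ht J hJ]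
  refine ⟨_, hbal, Set.Subset.antisymm ?_ ?_⟩
  · have hB := hM.isBiIdeal_tripleSet (α := α) hbal
    exact (biIdealClosure_subset_iff hB).2 ((key _ hB).1 subset_rfl)
  · exact (key _ (isBiIdeal_biIdealClosure _)).2 (subset_biIdealClosure _)

theorem IsM3.nonempty_orderIso (hM : IsM3 M a b c)
    (hstab : ∀ t : α × α × α, ∃ n : ℕ, 0 < n ∧ adjT^[n] t = adjT^[n + 1] t) :
    Nonempty (TensorProd M α ≃o {t : α × α × α // IsBalanced t}) := by
  let f : {t : α × α × α // IsBalanced t} ↪o TensorProd M α :=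
    OrderEmbedding.ofMapLEIff (fun t => ⟨tripleSet a b c t.1, hM.inTensor_tripleSet t.2⟩)
      fun t t' => (hM.tripleSet_subset_iff (hM.isBiIdeal_tripleSet t'.2) t.1).trans
        (hM.containsTriple_tripleSet_iff)
  have hf : Function.Surjective f := fun I => by
    obtain ⟨t, ht, hI⟩ := hM.exists_eq_tripleSet hstab I.2
    exact ⟨⟨t, ht⟩, Subtype.ext hI.symm⟩
  exact ⟨(RelIso.ofSurjective f hf).symm⟩

theorem IsM3.exists_isGLB (hM : IsM3 M a b c)
    (hstab : ∀ t : α × α × α, ∃ n : ℕ, 0 < n ∧ adjT^[n] t = adjT^[n + 1] t)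
    (I J : TensorProd M α) : ∃ K, IsGLB {I, J} K := by
  obtain ⟨t, ht, hI⟩ := hM.exists_eq_tripleSet hstab I.2
  obtain ⟨t', ht', hJ⟩ := hM.exists_eq_tripleSet hstab J.2
  have hK : tripleSet a b c (t ⊓ t') = I.1 ∩ J.1 := by rw [tripleSet_inf, hI, hJ]
  refine ⟨⟨_, hM.inTensor_tripleSet (ht.inf ht')⟩, ?_, fun L hL => ?_⟩
  · rintro L (rfl | rfl)
    · exact hK.trans_subset Set.inter_subset_left
    · exact hK.trans_subset Set.inter_subset_right
  · exact (Set.subset_inter (hL (Or.inl rfl)) (hL (Or.inr rfl))).trans_eq hK.symm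

theorem IsM3.exists_iterate_adjT_eq (hM : IsM3 M a b c)
    (hglb : ∀ I J : TensorProd M α, ∃ K, IsGLB {I, J} K) (t : α × α × α) :
    ∃ n : ℕ, 0 < n ∧ adjT^[n] t = adjT^[n + 1] t := by
  classical
  let s : Finset (M × α) := {(a, t.1), (b, t.2.1), (c, t.2.2)}
  let I : TensorProd M α := ⟨biIdealClosure (s : Set (M × α)), s, rfl⟩
  have hbi : IsBiIdeal I.1 := I.2.isBiIdeal
  have hmem : ∀ n, ContainsTriple a b c I.1 (adjT^[n] t) := fun n => by
    rw [hM.containsTriple_iterate_adjT_iff hbi]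
    have hs : (s : Set (M × α)) ⊆ I.1 := subset_biIdealClosure _
    simpa [s, ContainsTriple, Set.insert_subset_iff] using hs
  have hsub : I.1 ⊆ ⋃ n : ℕ, tripleSet a b c (adjT^[n] t) := by
    refine (biIdealClosure_subset_iff (hM.isBiIdeal_iUnion_tripleSet t)).2 ?_
    have ht := hM.containsTriple_tripleSet t
    have hs : (s : Set (M × α)) ⊆ tripleSet a b c t := by
      simpa [s, ContainsTriple, Set.insert_subset_iff] using ht
    exact hs.trans (Set.subset_iUnion (fun n : ℕ => tripleSet a b c (adjT^[n] t)) 0)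
  have hbdd : ∀ e : M, (a ≤ e ∨ b ≤ e ∨ c ≤ e) → BddAbove {u | (e, u) ∈ I.1} := by
    intro e he
    let w := t.1 ⊔ t.2.1 ⊔ t.2.2
    have hw : IsBiIdeal (tripleSet a b c (w, w, w)) :=
      hM.isBiIdeal_tripleSet ⟨rfl, rfl⟩
    have hsw : (s : Set (M × α)) ⊆ tripleSet a b c (w, w, w) := by
      have htw := (hM.containsTriple_tripleSet_iff).2 (show t ≤ (w, w, w) from
        ⟨le_sup_of_le_left le_sup_left, le_sup_of_le_left le_sup_right, le_sup_right⟩)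
      simpa [s, ContainsTriple, Set.insert_subset_iff] using htw
    refine ⟨w, fun u hu => ?_⟩
    obtain ⟨h₁, h₂, h₃⟩ := (biIdealClosure_subset_iff hw).2 hsw hu
    exact he.elim h₁ fun he => he.elim h₂ h₃
  obtain ⟨x, hx, hx'⟩ := TensorProd.exists_isGreatest_section hglb hM.isAtom I
    (hbdd a (Or.inl le_rfl))
  obtain ⟨y, hy, hy'⟩ := TensorProd.exists_isGreatest_section hglb hM.swap_left.isAtom I
    (hbdd b (Or.inr (Or.inl le_rfl)))
  obtain ⟨z, hz, hz'⟩ := TensorProd.exists_isGreatest_section hglb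
    hM.swap_right.swap_left.isAtom I (hbdd c (Or.inr (Or.inr le_rfl)))
  obtain ⟨i, hi⟩ := Set.mem_iUnion.1 (hsub hx)
  obtain ⟨j, hj⟩ := Set.mem_iUnion.1 (hsub hy)
  obtain ⟨k, hk⟩ := Set.mem_iUnion.1 (hsub hz)
  have hle : ∀ n, adjT^[n] t ≤ (x, y, z) := fun n =>
    ⟨hx' (hmem n).1, hy' (hmem n).2.1, hz' (hmem n).2.2⟩
  have hmono := monotone_iterate_adjT t
  let N := max i (max j k) + 1
  have hge : (x, y, z) ≤ adjT^[N] t :=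
    ⟨(hi.1 le_rfl).trans (hmono (show i ≤ N by omega)).1,
      (hj.2.1 le_rfl).trans (hmono (show j ≤ N by omega)).2.1,
      (hk.2.2 le_rfl).trans (hmono (show k ≤ N by omega)).2.2⟩
  exact ⟨N, Nat.succ_pos _, le_antisymm (hmono N.le_succ) ((hle _).trans hge)⟩

end DiamondTensor

/-- Let `L` be a lattice with zero.  Then `M₃ ⊗ L` is a lattice iff every triple of `L³`
has a stabilizing adjustment sequence; in that case `M₃ ⊗ L ≅ M₃[L]`.  In particular, if
`L` is `n`-modular for some `n > 0`, then `M₃ ⊗ L` is a lattice isomorphic to `M₃[L]`. -/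
theorem stmt11 {M : Type*} [Lattice M] [BoundedOrder M] {a b c : M} (hM : IsM3 M a b c)
    {α : Type*} [Lattice α] [OrderBot α] :
    (((∀ I J : TensorProd M α, ∃ K, IsLUB {I, J} K) ∧
      (∀ I J : TensorProd M α, ∃ K, IsGLB {I, J} K)) ↔
      (∀ t : α × α × α, ∃ n : ℕ, 0 < n ∧ adjT^[n] t = adjT^[n + 1] t)) ∧
    (((∀ I J : TensorProd M α, ∃ K, IsLUB {I, J} K) ∧
      (∀ I J : TensorProd M α, ∃ K, IsGLB {I, J} K)) →
      Nonempty (TensorProd M α ≃o {t : α × α × α // IsBalanced t})) ∧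
    (∀ n : ℕ, 0 < n → NModular α n →
      ((∀ I J : TensorProd M α, ∃ K, IsLUB {I, J} K) ∧
       (∀ I J : TensorProd M α, ∃ K, IsGLB {I, J} K)) ∧
      Nonempty (TensorProd M α ≃o {t : α × α × α // IsBalanced t})) := by
  have hglb := fun h => hM.exists_isGLB (α := α) h
  refine ⟨⟨fun h => hM.exists_iterate_adjT_eq h.2,
    fun h => ⟨TensorProd.exists_isLUB, hglb h⟩⟩,
    fun h => hM.nonempty_orderIso (hM.exists_iterate_adjT_eq h.2), fun n hn hmod => ?_⟩
  have hstab : ∀ t : α × α × α, ∃ n : ℕ, 0 < n ∧ adjT^[n] t = adjT^[n + 1] t :=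
    fun t => ⟨n, hn, hmod.iterate_adjT_eq t⟩
  exact ⟨⟨TensorProd.exists_isLUB, hglb hstab⟩, hM.nonempty_orderIso hstab⟩
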